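/- arXiv:1704.05728 — 3 statements merged into one kernel-verified Lean document; each statement's English description precedes it below -/
import Mathlib

section
/- Inversion formula for the Bloch–Floquet transform: let f ∈ L²_loc(ℝⁿ) satisfy Σ_{γ∈ℤⁿ} ‖f‖_{L²(W+γ)} < ∞. Then for almost every x ∈ ℝⁿ the series defining f̂(k,x) = Σ_{γ∈ℤⁿ} f(x+γ) e^{−i k·γ} converges absolutely for all k, and f(x) = ∫_{[0,2π)ⁿ} f̂(k,x) d'k for almost every x ∈ ℝⁿ. -/
noncomputable section

open MeasureTheory Filter

/-- The translated unit cell `W + γ = Π_j [γ_j, γ_j + 1)`. -/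
def cell (n : ℕ) (γ : Fin n → ℤ) : Set (Fin n → ℝ) :=
  Set.univ.pi fun j => Set.Ico (γ j : ℝ) ((γ j : ℝ) + 1)

/-- The quasimomentum box `[0,2π)ⁿ`. -/
def kbox (n : ℕ) : Set (Fin n → ℝ) := Set.univ.pi fun _ => Set.Ico (0 : ℝ) (2 * Real.pi)

/-- The normalized measure `d'k = (2π)⁻ⁿ dk` on the quasimomentum box `[0,2π)ⁿ`. -/
def qm (n : ℕ) : Measure (Fin n → ℝ) :=
  (ENNReal.ofReal ((2 * Real.pi) ^ n))⁻¹ • (volume.restrict (kbox n))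

/-- The phase `e^{-i k·γ}`. -/
def phase (n : ℕ) (k : Fin n → ℝ) (γ : Fin n → ℤ) : ℂ :=
  Complex.exp (-(Complex.I * ((∑ j, k j * (γ j : ℝ) : ℝ) : ℂ)))

/-- The translation of `ℝⁿ` by an integer vector. -/
def intShift (n : ℕ) (γ : Fin n → ℤ) (x : Fin n → ℝ) : Fin n → ℝ :=
  fun j => x j + (γ j : ℝ)

lemma intShift_zero (n : ℕ) (x : Fin n → ℝ) : intShift n 0 x = x := by
  ext j
  simp [intShift]

lemma measurePreserving_intShift (n : ℕ) (γ : Fin n → ℤ) :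
    MeasurePreserving (intShift n γ) volume volume :=
  measurePreserving_add_right volume fun j => (γ j : ℝ)

lemma measurableEmbedding_intShift (n : ℕ) (γ : Fin n → ℤ) :
    MeasurableEmbedding (intShift n γ) :=
  measurableEmbedding_addRight fun j => (γ j : ℝ)

lemma intShift_preimage_cell (n : ℕ) (γ δ : Fin n → ℤ) :
    intShift n γ ⁻¹' cell n (δ + γ) = cell n δ := by
  ext x
  simp only [cell, intShift, Set.mem_preimage, Set.mem_univ_pi, Set.mem_Ico, Pi.add_apply,
    Int.cast_add]
  refine forall_congr' fun j => ?_
  constructor <;> rintro ⟨h₁, h₂⟩ <;> constructor <;> linarith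

lemma volume_cell (n : ℕ) (γ : Fin n → ℤ) : volume (cell n γ) = 1 := by
  simp [cell, volume_pi_pi]

lemma iUnion_cell (n : ℕ) : ⋃ γ, cell n γ = Set.univ := by
  refine Set.eq_univ_of_forall fun x => Set.mem_iUnion.2 ⟨fun j => ⌊x j⌋, fun j _ => ?_⟩
  exact ⟨Int.floor_le _, Int.lt_floor_add_one _⟩

/-- On a cell, which has measure one, the `L¹` norm is at most the `L²` norm. -/
lemma lintegral_cell_le_eLpNorm {n : ℕ} {f : (Fin n → ℝ) → ℂ}
    (hf : AEStronglyMeasurable f volume) (γ : Fin n → ℤ) :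
    ∫⁻ x in cell n γ, ‖f x‖ₑ ≤ eLpNorm f 2 (volume.restrict (cell n γ)) := by
  have : IsProbabilityMeasure (volume.restrict (cell n γ)) :=
    ⟨by rw [Measure.restrict_apply_univ, volume_cell]⟩
  rw [← eLpNorm_one_eq_lintegral_enorm]
  exact eLpNorm_le_eLpNorm_of_exponent_le one_le_two hf.restrict

lemma ae_summable_norm_intShift {n : ℕ} {f : (Fin n → ℝ) → ℂ}
    (hf : AEStronglyMeasurable f volume)
    (hloc : ∀ γ : Fin n → ℤ, eLpNorm f 2 (volume.restrict (cell n γ)) < ⊤)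
    (hsum : Summable fun γ : Fin n → ℤ => (eLpNorm f 2 (volume.restrict (cell n γ))).toReal) :
    ∀ᵐ x ∂(volume : Measure (Fin n → ℝ)), Summable fun γ => ‖f (intShift n γ x)‖ := by
  have hfin : ∑' γ, eLpNorm f 2 (volume.restrict (cell n γ)) ≠ ⊤ := by
    have h := hsum.tsum_ofReal_ne_top
    simpa only [ENNReal.ofReal_toReal (hloc _).ne] using h
  have hcell (δ : Fin n → ℤ) :
      ∀ᵐ x ∂volume.restrict (cell n δ), Summable fun γ => ‖f (intShift n γ x)‖ := by
    have hmeas (γ : Fin n → ℤ) :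
        AEMeasurable (fun x => ‖f (intShift n γ x)‖ₑ) (volume.restrict (cell n δ)) :=
      (hf.comp_measurePreserving (measurePreserving_intShift n γ)).enorm.restrict
    have hlt : ∫⁻ x in cell n δ, ∑' γ, ‖f (intShift n γ x)‖ₑ ≠ ⊤ := by
      rw [lintegral_tsum hmeas]
      refine ne_top_of_le_ne_top hfin ?_
      calc ∑' γ, ∫⁻ x in cell n δ, ‖f (intShift n γ x)‖ₑ
          = ∑' γ, ∫⁻ x in cell n (δ + γ), ‖f x‖ₑ := tsum_congr fun γ => by
            rw [← intShift_preimage_cell n γ δ]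
            exact (measurePreserving_intShift n γ).setLIntegral_comp_preimage_emb
              (measurableEmbedding_intShift n γ) (fun x => ‖f x‖ₑ) _
        _ = ∑' γ, ∫⁻ x in cell n γ, ‖f x‖ₑ :=
            (Equiv.addLeft δ).tsum_eq fun γ => ∫⁻ x in cell n γ, ‖f x‖ₑ
        _ ≤ _ := ENNReal.tsum_le_tsum fun γ => lintegral_cell_le_eLpNorm hf γ
    filter_upwards [ae_lt_top' (AEMeasurable.tsum hmeas) hlt] with x hx
    simpa using ENNReal.summable_toReal hx.ne
  rw [← Measure.restrict_univ (μ := volume), ← iUnion_cell n]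
  exact (ae_restrict_iUnion_iff _ _).2 hcell

lemma norm_phase (n : ℕ) (k : Fin n → ℝ) (γ : Fin n → ℤ) : ‖phase n k γ‖ = 1 := by
  rw [phase, mul_comm, ← neg_mul, ← Complex.ofReal_neg, Complex.norm_exp_ofReal_mul_I]

lemma continuous_phase (n : ℕ) (γ : Fin n → ℤ) : Continuous fun k => phase n k γ := by
  unfold phase
  fun_prop

lemma phase_eq_prod (n : ℕ) (k : Fin n → ℝ) (γ : Fin n → ℤ) :
    phase n k γ = ∏ j, Complex.exp (-(Complex.I * (γ j : ℂ)) * (k j : ℂ)) := by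
  rw [phase, ← Complex.exp_sum]
  congr 1
  push_cast
  rw [Finset.mul_sum, ← Finset.sum_neg_distrib]
  exact Finset.sum_congr rfl fun j _ => by ring

lemma volume_kbox (n : ℕ) : volume (kbox n) = ENNReal.ofReal ((2 * Real.pi) ^ n) := by
  simp [kbox, volume_pi_pi, ENNReal.ofReal_pow Real.two_pi_pos.le]

instance isProbabilityMeasure_qm (n : ℕ) : IsProbabilityMeasure (qm n) := by
  constructor
  rw [qm, Measure.smul_apply, Measure.restrict_apply_univ, volume_kbox, smul_eq_mul]
  exact ENNReal.inv_mul_cancel (ENNReal.ofReal_pos.2 (pow_pos Real.two_pi_pos n)).ne'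
    ENNReal.ofReal_ne_top

lemma setIntegral_exp_int_mul_eq_zero {m : ℤ} (hm : m ≠ 0) :
    ∫ t in Set.Ico (0 : ℝ) (2 * Real.pi), Complex.exp (-(Complex.I * (m : ℂ)) * (t : ℂ)) = 0 := by
  have hc : -(Complex.I * (m : ℂ)) ≠ 0 := by simpa using hm
  have hperiod : -(Complex.I * (m : ℂ)) * ((2 * Real.pi : ℝ) : ℂ) =
      ((-m : ℤ) : ℂ) * (2 * Real.pi * Complex.I) := by
    push_cast
    ring
  rw [integral_Ico_eq_integral_Ioc, ← intervalIntegral.integral_of_le Real.two_pi_pos.le,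
    integral_exp_mul_complex hc, hperiod, Complex.exp_int_mul_two_pi_mul_I]
  simp

lemma integral_phase_eq_zero {n : ℕ} {γ : Fin n → ℤ} (hγ : γ ≠ 0) :
    ∫ k, phase n k γ ∂(qm n) = 0 := by
  obtain ⟨j, hj⟩ := Function.ne_iff.1 hγ
  simp_rw [phase_eq_prod]
  rw [qm, integral_smul_measure, kbox, volume_pi, Measure.restrict_pi_pi,
    integral_fintype_prod_eq_prod (𝕜 := ℂ)
      (f := fun j (t : ℝ) => Complex.exp (-(Complex.I * (γ j : ℂ)) * (t : ℂ))),
    Finset.prod_eq_zero (Finset.mem_univ j) (setIntegral_exp_int_mul_eq_zero hj), smul_zero]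

/-- Integrating an absolutely convergent trigonometric series recovers its constant term. -/
lemma integral_tsum_mul_phase {n : ℕ} {c : (Fin n → ℤ) → ℂ} (hc : Summable fun γ => ‖c γ‖) :
    ∫ k, (∑' γ, c γ * phase n k γ) ∂(qm n) = c 0 := by
  have hint (γ : Fin n → ℤ) : Integrable (fun k => c γ * phase n k γ) (qm n) :=
    Integrable.of_bound (continuous_const.mul (continuous_phase n γ)).aestronglyMeasurable ‖c γ‖
      (ae_of_all _ fun k => by rw [norm_mul, norm_phase, mul_one])
  have h := hasSum_integral_of_summable_integral_norm hint
    (by simpa [norm_phase] using hc)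
  rw [← h.tsum_eq, tsum_eq_single 0 fun γ hγ => by
    rw [integral_const_mul, integral_phase_eq_zero hγ, mul_zero]]
  simp [phase]

/-- inversion formula for the Bloch–Floquet transform. If `f ∈ L²_loc(ℝⁿ)` with
`Σ_{γ∈ℤⁿ} ‖f‖_{L²(W+γ)} < ∞`, then for a.e. `x` the series `f̂(k,x) = Σ_γ f(x+γ)e^{-ik·γ}`
converges absolutely for all `k` and `f(x) = ∫_{[0,2π)ⁿ} f̂(k,x) d'k`. -/
theorem blochFloquet_inversion (n : ℕ) (f : (Fin n → ℝ) → ℂ)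
    (hmeas : AEStronglyMeasurable f (volume : Measure (Fin n → ℝ)))
    (hloc : ∀ γ : Fin n → ℤ, eLpNorm f 2 (volume.restrict (cell n γ)) < ⊤)
    (hsum : Summable fun γ : Fin n → ℤ => (eLpNorm f 2 (volume.restrict (cell n γ))).toReal) :
    ∀ᵐ x ∂(volume : Measure (Fin n → ℝ)),
      (∀ k : Fin n → ℝ,
        Summable fun γ : Fin n → ℤ => ‖f (fun j => x j + (γ j : ℝ)) * phase n k γ‖) ∧
      f x = ∫ k, (∑' γ : Fin n → ℤ, f (fun j => x j + (γ j : ℝ)) * phase n k γ) ∂(qm n) := by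
  filter_upwards [ae_summable_norm_intShift hmeas hloc hsum] with x hx
  refine ⟨fun k => ?_, ?_⟩
  · simp_rw [norm_mul, norm_phase, mul_one]
    exact hx
  · exact (congrArg f (intShift_zero n x)).symm.trans (integral_tsum_mul_phase hx).symm
end
end

section
/- Paley–Wiener type theorem for the Bloch–Floquet transform (decay implies analyticity): let α > 0 and let f ∈ L²_loc(ℝⁿ) satisfy, for every b with 0 < b < α, sup_{γ∈ℤⁿ} e^{b‖γ‖₁} ‖f‖_{L²(W+γ)} < ∞, where ‖γ‖₁ = Σ_j |γ_j|. Then there exists an analytic (holomorphic) function F from the complex strip D_α = {k ∈ ℂⁿ : |Im k_j| < α for j = 1,…,n} to the Hilbert space L²(W) such that for every real k ∈ ℝⁿ, F(k) equals f̂(k,·), the function x ↦ Σ_{γ∈ℤⁿ} f(x+γ) e^{−i k·γ} in L²(W). -/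
noncomputable section

open MeasureTheory

/-- The fundamental domain `W = [0,1)ⁿ` of the lattice `ℤⁿ` acting on `ℝⁿ`. -/
def Wbox (n : ℕ) : Set (Fin n → ℝ) := Set.univ.pi fun _ => Set.Ico (0 : ℝ) 1

/-- The complex strip `D_α = {k ∈ ℂⁿ : |Im k_j| < α for all j}`. -/
def strip (n : ℕ) (α : ℝ) : Set (Fin n → ℂ) := {k | ∀ j, |(k j).im| < α}

/-- The `ℓ¹` norm `‖γ‖₁ = Σ_j |γ_j|` of a lattice vector. -/
def l1norm (n : ℕ) (γ : Fin n → ℤ) : ℝ := ∑ j, |(γ j : ℝ)|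

open scoped NNReal ENNReal Topology

/-- A product of summable nonnegative functions is summable over the finite product of the index
types. -/
theorem summable_pi_prod_of_nonneg {ι κ : Type*} [Fintype ι] {g : κ → ℝ}
    (hg : ∀ a, 0 ≤ g a) (hs : Summable g) : Summable fun x : ι → κ => ∏ i, g (x i) := by
  classical
  refine summable_of_sum_le (c := ∏ _i : ι, ∑' a, g a)
    (fun x => Finset.prod_nonneg fun i _ => hg (x i)) fun s => ?_
  calc ∑ x ∈ s, ∏ i, g (x i)
      ≤ ∑ x ∈ Fintype.piFinset fun i : ι => s.image fun x => x i, ∏ i, g (x i) := by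
        refine Finset.sum_le_sum_of_subset_of_nonneg (fun x hx => ?_)
          fun x _ _ => Finset.prod_nonneg fun i _ => hg (x i)
        exact Fintype.mem_piFinset.2 fun i => Finset.mem_image_of_mem (fun x => x i) hx
    _ = ∏ i : ι, ∑ a ∈ s.image fun x => x i, g a := (Finset.prod_univ_sum _ fun _ => g).symm
    _ ≤ ∏ _i : ι, ∑' a, g a :=
        Finset.prod_le_prod (fun i _ => Finset.sum_nonneg fun a _ => hg a)
          fun i _ => hs.sum_le_tsum _ fun a _ => hg a

theorem summable_exp_neg_mul_l1norm (n : ℕ) {c : ℝ} (hc : 0 < c) :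
    Summable fun γ : Fin n → ℤ => Real.exp (-(c * l1norm n γ)) := by
  have h : Summable fun m : ℤ => Real.exp (-(c * |(m : ℝ)|)) := by
    have hnat : Summable fun m : ℕ => Real.exp (-(c * m)) := by
      simpa [mul_comm] using Real.summable_exp_nat_mul_iff.2 (neg_lt_zero.2 hc)
    exact Summable.of_nat_of_neg (by simpa using hnat) (by simpa using hnat)
  refine (summable_pi_prod_of_nonneg (ι := Fin n) (fun m => (Real.exp_pos _).le) h).congr
    fun γ => ?_
  rw [← Real.exp_sum, l1norm, Finset.mul_sum, Finset.sum_neg_distrib]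

section ExponentialSeries

variable {E V ι : Type*} [NormedAddCommGroup E] [NormedSpace ℂ E]
  [NormedAddCommGroup V] [NormedSpace ℂ V]

/-- The `m`-th Taylor coefficient at the origin of `z ↦ exp (ℓ z) • v`. -/
def expSMulCoeff (ℓ : E →L[ℂ] ℂ) (v : V) (m : ℕ) : E [×m]→L[ℂ] V :=
  ((m.factorial : ℂ)⁻¹) •
    ((ContinuousMultilinearMap.mkPiAlgebraFin ℂ m ℂ).compContinuousLinearMap
      fun _ => ℓ).smulRight v

theorem expSMulCoeff_apply_const (ℓ : E →L[ℂ] ℂ) (v : V) (m : ℕ) (z : E) :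
    expSMulCoeff ℓ v m (fun _ => z) = (ℓ z ^ m / m.factorial) • v := by
  simp [expSMulCoeff, smul_smul, div_eq_inv_mul]

theorem norm_expSMulCoeff_le (ℓ : E →L[ℂ] ℂ) (v : V) (m : ℕ) :
    ‖expSMulCoeff ℓ v m‖ ≤ ‖ℓ‖ ^ m / m.factorial * ‖v‖ := by
  refine ContinuousMultilinearMap.opNorm_le_bound (by positivity) fun z => ?_
  have h : ‖∏ i, ℓ (z i)‖ ≤ ‖ℓ‖ ^ m * ∏ i, ‖z i‖ := by
    rw [norm_prod]
    calc ∏ i, ‖ℓ (z i)‖ ≤ ∏ i, ‖ℓ‖ * ‖z i‖ :=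
          Finset.prod_le_prod (fun _ _ => norm_nonneg _) fun i _ => ℓ.le_opNorm _
      _ = ‖ℓ‖ ^ m * ∏ i, ‖z i‖ := by simp [Finset.prod_mul_distrib]
  calc ‖expSMulCoeff ℓ v m z‖ = ‖∏ i, ℓ (z i)‖ * ((m.factorial : ℝ)⁻¹ * ‖v‖) := by
        simp [expSMulCoeff, norm_smul, List.prod_ofFn]; ring
    _ ≤ ‖ℓ‖ ^ m * (∏ i, ‖z i‖) * ((m.factorial : ℝ)⁻¹ * ‖v‖) := by gcongr
    _ = _ := by ring

/-- A series of vector-valued exponentials whose terms are summable, uniformly on a ball around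
the origin, is analytic at the origin. -/
theorem analyticAt_tsum_exp_smul [CompleteSpace V] (ℓ : ι → E →L[ℂ] ℂ) (v : ι → V) {r : ℝ≥0}
    (hr : 0 < r) (hs : Summable fun i => Real.exp (‖ℓ i‖ * r) * ‖v i‖) :
    AnalyticAt ℂ (fun z => ∑' i, Complex.exp (ℓ i z) • v i) 0 := by
  have hexp (x : ℝ) : HasSum (fun m : ℕ => x ^ m / m.factorial) (Real.exp x) := by
    rw [Real.exp_eq_exp_ℝ]; exact NormedSpace.expSeries_div_hasSum_exp x
  have hbound : Summable fun q : ι × ℕ => (‖ℓ q.1‖ * r) ^ q.2 / q.2.factorial * ‖v q.1‖ := by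
    have hnonneg : 0 ≤ fun q : ι × ℕ => (‖ℓ q.1‖ * r) ^ q.2 / q.2.factorial * ‖v q.1‖ :=
      fun q => by dsimp only [Pi.zero_apply]; positivity
    refine (summable_prod_of_nonneg hnonneg).2
      ⟨fun i => (hexp (‖ℓ i‖ * r)).summable.mul_right ‖v i‖, hs.congr fun i => ?_⟩
    exact ((hexp (‖ℓ i‖ * r)).mul_right ‖v i‖).tsum_eq.symm
  have hcoeff : Summable fun q : ι × ℕ => ‖expSMulCoeff (ℓ q.1) (v q.1) q.2‖ * (r : ℝ) ^ q.2 := by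
    refine hbound.of_nonneg_of_le (fun q => by positivity) fun q => ?_
    calc _ ≤ ‖ℓ q.1‖ ^ q.2 / q.2.factorial * ‖v q.1‖ * (r : ℝ) ^ q.2 := by
          gcongr; exact norm_expSMulCoeff_le _ _ _
      _ = _ := by ring
  have hsum (m : ℕ) : Summable fun i => ‖expSMulCoeff (ℓ i) (v i) m‖ := by
    have := (hcoeff.prod_symm.prod_factor m).mul_right ((r : ℝ) ^ m)⁻¹
    refine this.congr fun i => ?_
    have : (r : ℝ) ≠ 0 := by exact_mod_cast hr.ne'
    simp only [Prod.swap]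
    field_simp
  let p : FormalMultilinearSeries ℂ E V := fun m => ∑' i, expSMulCoeff (ℓ i) (v i) m
  refine ⟨p, r, ⟨?_, by exact_mod_cast hr, fun {z} hz => ?_⟩⟩
  · refine p.le_radius_of_summable (hcoeff.prod_symm.prod.of_nonneg_of_le
      (fun m => by positivity) fun m => ?_)
    simp only [Prod.swap, tsum_mul_right]
    gcongr
    exact norm_tsum_le_tsum_norm (hsum m)
  · have hz' : ‖z‖ ≤ r := by
      simpa [← NNReal.coe_le_coe] using (Metric.mem_eball.1 hz).le
    have hterm : Summable fun q : ι × ℕ => (ℓ q.1 z ^ q.2 / (q.2.factorial : ℂ)) • v q.1 := by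
      refine Summable.of_norm_bounded hbound fun q => ?_
      rw [norm_smul, norm_div, norm_pow, Complex.norm_natCast]
      gcongr
      exact ((ℓ q.1).le_opNorm z).trans (by gcongr)
    have hrow (i : ι) : HasSum (fun m : ℕ => (ℓ i z ^ m / (m.factorial : ℂ)) • v i)
        (Complex.exp (ℓ i z) • v i) := by
      rw [Complex.exp_eq_exp_ℂ]
      exact (NormedSpace.expSeries_div_hasSum_exp (ℓ i z)).smul_const _
    have htot := hterm.hasSum.prod_fiberwise hrow
    rw [zero_add, htot.tsum_eq]
    refine (((Equiv.prodComm ℕ ι).hasSum_iff).2 hterm.hasSum).prod_fiberwise fun m => ?_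
    have := (hsum m).of_norm.hasSum.mapL
      (ContinuousMultilinearMap.apply ℂ (fun _ : Fin m => E) V fun _ => z)
    simpa [p, Function.comp_def, expSMulCoeff_apply_const] using this

end ExponentialSeries

theorem measurePreserving_add_int_Wbox (n : ℕ) (γ : Fin n → ℤ) :
    MeasurePreserving (fun (x : Fin n → ℝ) j => x j + (γ j : ℝ))
      (volume.restrict (Wbox n)) (volume.restrict (cell n γ)) := by
  have hpre : (fun (x : Fin n → ℝ) j => x j + (γ j : ℝ)) ⁻¹' cell n γ = Wbox n := by
    ext x
    simp [cell, Wbox, Set.mem_pi, add_comm _ (1 : ℝ)]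
  have hcell : MeasurableSet (cell n γ) := MeasurableSet.univ_pi fun _ => measurableSet_Ico
  rw [← hpre]
  exact (measurePreserving_add_right volume fun j => (γ j : ℝ)).restrict_preimage hcell

/-- The linear form `z ↦ -i z·γ` on `ℂⁿ`. -/
def phaseForm (n : ℕ) (γ : Fin n → ℤ) : (Fin n → ℂ) →L[ℂ] ℂ :=
  -(Complex.I • ∑ j, (γ j : ℂ) • ContinuousLinearMap.proj j)

theorem phaseForm_apply (n : ℕ) (γ : Fin n → ℤ) (z : Fin n → ℂ) :
    phaseForm n γ z = -(Complex.I * ∑ j, z j * (γ j : ℂ)) := by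
  simp [phaseForm, mul_comm]

theorem norm_phaseForm_le (n : ℕ) (γ : Fin n → ℤ) : ‖phaseForm n γ‖ ≤ l1norm n γ := by
  refine ContinuousLinearMap.opNorm_le_bound _ (Finset.sum_nonneg fun _ _ => abs_nonneg _)
    fun z => ?_
  rw [phaseForm_apply, norm_neg, norm_mul, Complex.norm_I, one_mul, l1norm, Finset.sum_mul]
  refine norm_sum_le_of_le _ fun j _ => ?_
  rw [norm_mul, Complex.norm_intCast, mul_comm]
  gcongr
  exact norm_le_pi_norm z j

theorem re_phaseForm_le (n : ℕ) (γ : Fin n → ℤ) {k : Fin n → ℂ} {β : ℝ}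
    (hk : ∀ j, |(k j).im| ≤ β) : (phaseForm n γ k).re ≤ β * l1norm n γ := by
  have hre : (phaseForm n γ k).re = ∑ j, (k j).im * (γ j : ℝ) := by
    simp [phaseForm_apply]
  rw [hre, l1norm, Finset.mul_sum]
  refine Finset.sum_le_sum fun j _ => (le_abs_self _).trans ?_
  rw [abs_mul]
  gcongr
  exact hk j

theorem cexp_phaseForm_ofReal (n : ℕ) (γ : Fin n → ℤ) (k : Fin n → ℝ) :
    Complex.exp (phaseForm n γ fun j => (k j : ℂ)) = phase n k γ := by
  simp [phaseForm_apply, phase]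

theorem exists_uniform_bound_of_mem_strip {n : ℕ} {α : ℝ} (hα : 0 < α) {k : Fin n → ℂ}
    (hk : k ∈ strip n α) : ∃ β, 0 ≤ β ∧ β < α ∧ ∀ j, |(k j).im| ≤ β :=
  ⟨‖fun j => (k j).im‖, norm_nonneg _, (pi_norm_lt_iff hα).2 hk,
    fun j => norm_le_pi_norm (fun j => (k j).im) j⟩

/-- If the coefficients `v γ` decay exponentially at every rate below `α`, then the series
`∑ γ, e^{-i k·γ} v γ` is absolutely summable at every point of the strip, with some room to
spare. -/
theorem exists_summable_exp_phaseForm {V : Type*} [NormedAddCommGroup V] [NormedSpace ℂ V]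
    {n : ℕ} {α : ℝ} (hα : 0 < α) {v : (Fin n → ℤ) → V}
    (hv : ∀ b : ℝ, 0 < b → b < α → ∃ C : ℝ, ∀ γ, Real.exp (b * l1norm n γ) * ‖v γ‖ ≤ C)
    {k : Fin n → ℂ} (hk : k ∈ strip n α) :
    ∃ r : ℝ≥0, 0 < r ∧ Summable fun γ =>
      Real.exp (‖phaseForm n γ‖ * r) * ‖Complex.exp (phaseForm n γ k) • v γ‖ := by
  obtain ⟨β, hβ0, hβα, hβ⟩ := exists_uniform_bound_of_mem_strip hα hk
  obtain ⟨δ, hδ, hαδ⟩ : ∃ δ, 0 < δ ∧ β + 3 * δ = α := ⟨(α - β) / 3, by linarith, by ring⟩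
  obtain ⟨C, hC⟩ := hv (β + 2 * δ) (by linarith) (by linarith)
  refine ⟨⟨δ, hδ.le⟩, hδ, ((summable_exp_neg_mul_l1norm n hδ).mul_right C).of_nonneg_of_le
    (fun γ => by positivity) fun γ => ?_⟩
  rw [norm_smul, Complex.norm_exp]
  calc Real.exp (‖phaseForm n γ‖ * δ) * (Real.exp (phaseForm n γ k).re * ‖v γ‖)
      ≤ Real.exp (l1norm n γ * δ) * (Real.exp (β * l1norm n γ) * ‖v γ‖) := by
        gcongr
        · exact norm_phaseForm_le n γ
        · exact re_phaseForm_le n γ hβ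
    _ = Real.exp (-(δ * l1norm n γ)) * (Real.exp ((β + 2 * δ) * l1norm n γ) * ‖v γ‖) := by
        simp only [← mul_assoc, ← Real.exp_add]
        ring_nf
    _ ≤ _ := by gcongr; exact hC γ

/-- Paley–Wiener type theorem for the Bloch–Floquet transform (decay implies
analyticity). If for every `0 < b < α` we have `sup_γ e^{b‖γ‖₁}‖f‖_{L²(W+γ)} < ∞`, then the
Bloch–Floquet transform of `f` extends to an analytic `L²(W)`-valued function on the strip
`D_α`. -/
theorem blochFloquet_paleyWiener (n : ℕ) (α : ℝ) (hα : 0 < α) (f : (Fin n → ℝ) → ℂ)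
    (hmeas : AEStronglyMeasurable f (volume : Measure (Fin n → ℝ)))
    (hloc : ∀ γ : Fin n → ℤ, eLpNorm f 2 (volume.restrict (cell n γ)) < ⊤)
    (hdecay : ∀ b : ℝ, 0 < b → b < α → ∃ C : ℝ, ∀ γ : Fin n → ℤ,
      Real.exp (b * l1norm n γ) * (eLpNorm f 2 (volume.restrict (cell n γ))).toReal ≤ C) :
    ∃ F : (Fin n → ℂ) → Lp ℂ 2 (volume.restrict (Wbox n)),
      -- `F` is analytic (holomorphic) on the strip `D_α`:
      (∀ k ∈ strip n α, AnalyticAt ℂ F k) ∧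
      -- for real quasimomenta `k`, `F k` is the Bloch–Floquet transform `f̂(k,·)` in `L²(W)`:
      ∀ k : Fin n → ℝ,
        (F (fun j => (k j : ℂ)) : (Fin n → ℝ) → ℂ)
          =ᵐ[volume.restrict (Wbox n)]
        fun x => ∑' γ : Fin n → ℤ, f (fun j => x j + (γ j : ℝ)) * phase n k γ := by
  have hcellmeas (γ : Fin n → ℤ) : AEStronglyMeasurable f (volume.restrict (cell n γ)) :=
    hmeas.restrict
  have hshift (γ : Fin n → ℤ) :
      eLpNorm (fun x => f fun j => x j + (γ j : ℝ)) 2 (volume.restrict (Wbox n)) =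
        eLpNorm f 2 (volume.restrict (cell n γ)) :=
    eLpNorm_comp_measurePreserving (hcellmeas γ) (measurePreserving_add_int_Wbox n γ)
  have hmem (γ : Fin n → ℤ) :
      MemLp (fun x => f fun j => x j + (γ j : ℝ)) 2 (volume.restrict (Wbox n)) :=
    ⟨(hcellmeas γ).comp_measurePreserving (measurePreserving_add_int_Wbox n γ),
      (hshift γ).trans_lt (hloc γ)⟩
  let v (γ : Fin n → ℤ) : Lp ℂ 2 (volume.restrict (Wbox n)) := (hmem γ).toLp _
  have hv (b : ℝ) (hb0 : 0 < b) (hbα : b < α) :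
      ∃ C : ℝ, ∀ γ, Real.exp (b * l1norm n γ) * ‖v γ‖ ≤ C := by
    simpa only [v, Lp.norm_toLp, hshift] using hdecay b hb0 hbα
  refine ⟨fun k => ∑' γ, Complex.exp (phaseForm n γ k) • v γ, fun k hk => ?_, fun k => ?_⟩
  · obtain ⟨r, hr, hs⟩ := exists_summable_exp_phaseForm hα hv hk
    have h := analyticAt_tsum_exp_smul (phaseForm n)
      (fun γ => Complex.exp (phaseForm n γ k) • v γ) hr hs
    have hsub : AnalyticAt ℂ (fun z => z - k) k := by fun_prop
    convert h.comp_of_eq hsub (sub_self k) using 4 with z γ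
    simp [smul_smul, ← Complex.exp_add]
  · have hk : (fun j => (k j : ℂ)) ∈ strip n α := fun j => by simpa using hα
    obtain ⟨r, hr, hs⟩ := exists_summable_exp_phaseForm hα hv hk
    have hnorm : Summable fun γ => ‖Complex.exp (phaseForm n γ fun j => (k j : ℂ)) • v γ‖ :=
      hs.of_nonneg_of_le (fun _ => norm_nonneg _) fun γ =>
        le_mul_of_one_le_left (norm_nonneg _) (Real.one_le_exp (by positivity))
    have htop : ∑' γ, ‖Complex.exp (phaseForm n γ fun j => (k j : ℂ)) • v γ‖ₑ ≠ ∞ := by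
      simpa only [ofReal_norm] using hnorm.tsum_ofReal_ne_top
    have hterm : ∀ᵐ x ∂volume.restrict (Wbox n), ∀ γ,
        (Complex.exp (phaseForm n γ fun j => (k j : ℂ)) • v γ : Lp ℂ 2 _) x =
          f (fun j => x j + (γ j : ℝ)) * phase n k γ := by
      refine ae_all_iff.2 fun γ => ?_
      filter_upwards [Lp.coeFn_smul (Complex.exp (phaseForm n γ fun j => (k j : ℂ))) (v γ),
        (hmem γ).coeFn_toLp] with x hx hx'
      rw [hx, Pi.smul_apply, hx', cexp_phaseForm_ofReal, smul_eq_mul, mul_comm]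
    filter_upwards [Lp.coeFn_tsum htop, hterm] with x hx hx'
    rw [hx]
    exact tsum_congr hx'
end
end

section
/- Let φ : ℝⁿ × ℝⁿ → ℂ be jointly measurable, 2πℤⁿ-periodic in the first variable k, of Bloch form in the second variable, i.e. φ(k, x+γ) = e^{i k·γ} φ(k, x) for all γ ∈ ℤⁿ and a.e. (k,x), and satisfy ∫_{[0,2π)ⁿ} ∫_{[0,1)ⁿ} |φ(k,x)|² dx d'k < ∞. Define the Wannier function w(x) = ∫_{[0,2π)ⁿ} φ(k,x) d'k and its lattice shifts w_γ(x) = w(x−γ) for γ ∈ ℤⁿ. Then the functions {w_γ}_{γ∈ℤⁿ} are mutually orthogonal in L²(ℝⁿ) if and only if the function k ↦ ‖φ(k,·)‖_{L²(W)} is constant for almost every k ∈ [0,2π)ⁿ. -/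
noncomputable section

open MeasureTheory

/-- The Wannier function associated to the family of Bloch functions `φ(k,·)`. -/
def wannier (n : ℕ) (φ : (Fin n → ℝ) → (Fin n → ℝ) → ℂ) (x : Fin n → ℝ) : ℂ :=
  ∫ k, φ k x ∂(qm n)

/-- The rescaled fundamental-domain section `ℝ/ℤ → [0,2π)`. -/
def angle (t : UnitAddCircle) : ℝ := 2 * Real.pi * (AddCircle.equivIoc (1 : ℝ) 0 t : ℝ)

theorem measurePreserving_angle :
    MeasurePreserving angle (AddCircle.haarAddCircle (T := 1))
      ((ENNReal.ofReal (2 * Real.pi))⁻¹ • volume.restrict (Set.Ico 0 (2 * Real.pi))) := by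
  have h2 : (0 : ℝ) < 2 * Real.pi := Real.two_pi_pos
  have h := (measurePreserving_subtype_coe (μa := volume) (measurableSet_Ioc
    (a := (0 : ℝ)) (b := 0 + 1))).comp (AddCircle.measurePreserving_equivIoc (1 : ℝ) (a := 0))
  rw [AddCircle.volume_eq_smul_haarAddCircle] at h
  simp only [ENNReal.ofReal_one, one_smul, zero_add] at h
  have hs : MeasurePreserving (fun x : ℝ => 2 * Real.pi * x) (volume.restrict (Set.Ioc 0 1))
      ((ENNReal.ofReal (2 * Real.pi))⁻¹ • volume.restrict (Set.Ico 0 (2 * Real.pi))) := by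
    refine ⟨by fun_prop, ?_⟩
    have hpre : Set.Ioc (0 : ℝ) 1
        = (fun x : ℝ => 2 * Real.pi * x) ⁻¹' Set.Ioc 0 (2 * Real.pi) := by
      ext x
      simp only [Set.mem_Ioc, Set.mem_preimage, mul_pos_iff_of_pos_left h2]
      rw [mul_le_iff_le_one_right h2]
    rw [hpre, ← Measure.restrict_map (by fun_prop) measurableSet_Ioc,
      Real.map_volume_mul_left h2.ne', Measure.restrict_smul,
      Measure.restrict_congr_set Ico_ae_eq_Ioc, abs_of_pos (inv_pos.2 h2),
      ENNReal.ofReal_inv_of_pos h2]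
  exact hs.comp h

/-- The Haar probability measure on the torus `(ℝ/ℤ)ⁿ`. -/
abbrev torusHaar (n : ℕ) : Measure (UnitAddTorus (Fin n)) :=
  Measure.pi fun _ => AddCircle.haarAddCircle (T := 1)

/-- The identification of the torus `(ℝ/ℤ)ⁿ` with the quasimomentum box. -/
def angles (n : ℕ) (t : UnitAddTorus (Fin n)) : Fin n → ℝ := fun j => angle (t j)

theorem qm_eq_pi (n : ℕ) : qm n = Measure.pi fun _ : Fin n =>
    (ENNReal.ofReal (2 * Real.pi))⁻¹ • volume.restrict (Set.Ico 0 (2 * Real.pi)) := by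
  have : IsFiniteMeasure ((ENNReal.ofReal (2 * Real.pi))⁻¹ •
      (volume.restrict (Set.Ico 0 (2 * Real.pi)) : Measure ℝ)) :=
    Measure.smul_finite _ (by simp [Real.pi_pos])
  refine (Measure.pi_eq fun s _ => ?_).symm
  rw [qm, kbox, volume_pi, Measure.restrict_pi_pi]
  simp only [Measure.smul_apply, Measure.pi_pi, smul_eq_mul, Finset.prod_mul_distrib,
    Finset.prod_const, Finset.card_univ, Fintype.card_fin]
  rw [ENNReal.ofReal_pow Real.two_pi_pos.le, ENNReal.inv_pow]

theorem measurePreserving_angles (n : ℕ) :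
    MeasurePreserving (angles n) (torusHaar n) (qm n) := by
  have : IsFiniteMeasure ((ENNReal.ofReal (2 * Real.pi))⁻¹ •
      (volume.restrict (Set.Ico 0 (2 * Real.pi)) : Measure ℝ)) :=
    Measure.smul_finite _ (by simp [Real.pi_pos])
  rw [qm_eq_pi]
  exact measurePreserving_pi _ _ fun _ => measurePreserving_angle

/-- The plane wave `k ↦ e^{i k·γ}`. -/
def planeWave {n : ℕ} (γ : Fin n → ℤ) (k : Fin n → ℝ) : ℂ :=
  Complex.exp (Complex.I * ((∑ j, k j * (γ j : ℝ) : ℝ) : ℂ))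

theorem planeWave_angles {n : ℕ} (γ : Fin n → ℤ) (t : UnitAddTorus (Fin n)) :
    planeWave γ (angles n t) = UnitAddTorus.mFourier γ t := by
  have h (j : Fin n) : fourier (γ j) (t j) = Complex.exp (Complex.I * (angles n t j * γ j)) := by
    conv_lhs => rw [← AddCircle.coe_equivIoc (p := (1 : ℝ)) (a := 0) (y := t j)]
    rw [fourier_coe_apply]
    congr 1
    simp only [angles, angle]
    push_cast
    ring
  simp only [UnitAddTorus.mFourier, ContinuousMap.coe_mk, h, planeWave]
  rw [← Complex.exp_sum, ← Finset.mul_sum]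
  push_cast
  rfl

instance (n : ℕ) : IsProbabilityMeasure (qm n) :=
  (measurePreserving_angles n).map_eq ▸
    Measure.isProbabilityMeasure_map (measurePreserving_angles n).measurable.aemeasurable

theorem measurable_planeWave {n : ℕ} (γ : Fin n → ℤ) : Measurable (planeWave γ) := by
  unfold planeWave
  fun_prop

theorem norm_planeWave {n : ℕ} (γ : Fin n → ℤ) (k : Fin n → ℝ) : ‖planeWave γ k‖ = 1 := by
  rw [planeWave, mul_comm, Complex.norm_exp_ofReal_mul_I]

theorem planeWave_zero {n : ℕ} (k : Fin n → ℝ) : planeWave (0 : Fin n → ℤ) k = 1 := by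
  simp [planeWave]

theorem planeWave_add {n : ℕ} (γ δ : Fin n → ℤ) (k : Fin n → ℝ) :
    planeWave (γ + δ) k = planeWave γ k * planeWave δ k := by
  simp only [planeWave, ← Complex.exp_add, ← mul_add, ← Complex.ofReal_add,
    ← Finset.sum_add_distrib, Pi.add_apply, Int.cast_add]

theorem conj_planeWave {n : ℕ} (γ : Fin n → ℤ) (k : Fin n → ℝ) :
    (starRingEnd ℂ) (planeWave γ k) = planeWave (-γ) k := by
  simp [planeWave, ← Complex.exp_conj]

theorem integral_qm_eq {n : ℕ} {f : (Fin n → ℝ) → ℂ} (hf : AEStronglyMeasurable f (qm n)) :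
    ∫ k, f k ∂qm n = ∫ t, f (angles n t) ∂torusHaar n := by
  rw [← (measurePreserving_angles n).map_eq] at hf ⊢
  exact integral_map (measurePreserving_angles n).measurable.aemeasurable hf

/-- Parseval's identity for multiple Fourier series on the quasimomentum box. -/
theorem hasSum_mul_conj_integral_planeWave {n : ℕ} {f g : (Fin n → ℝ) → ℂ}
    (hf : MemLp f 2 (qm n)) (hg : MemLp g 2 (qm n)) :
    HasSum (fun δ : Fin n → ℤ => (∫ k, planeWave δ k * f k ∂qm n)
      * (starRingEnd ℂ) (∫ k, planeWave δ k * g k ∂qm n))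
      (∫ k, f k * (starRingEnd ℂ) (g k) ∂qm n) := by
  have hf' := hf.comp_measurePreserving (measurePreserving_angles n)
  have hg' := hg.comp_measurePreserving (measurePreserving_angles n)
  have key : HasSum (fun i ↦
      (starRingEnd ℂ) (∫ t, UnitAddTorus.mFourier (-i) t * hg'.toLp _ t ∂torusHaar n)
        * (∫ t, UnitAddTorus.mFourier (-i) t * hf'.toLp _ t ∂torusHaar n))
      (∫ t, (starRingEnd ℂ) (hg'.toLp _ t) * hf'.toLp _ t ∂torusHaar n) :=
    UnitAddTorus.hasSum_prod_mFourierCoeff (d := Fin n) (hg'.toLp _) (hf'.toLp _)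
  rw [← (Equiv.neg (Fin n → ℤ)).hasSum_iff] at key
  have coeff {h : (Fin n → ℝ) → ℂ} (hh : MemLp h 2 (qm n))
      (hh' : MemLp (h ∘ angles n) 2 (torusHaar n)) (i : Fin n → ℤ) :
      ∫ t, UnitAddTorus.mFourier i t * hh'.toLp _ t ∂torusHaar n
        = ∫ k, planeWave i k * h k ∂qm n := by
    rw [integral_qm_eq (f := fun k => planeWave i k * h k)
      ((measurable_planeWave i).aestronglyMeasurable.mul hh.1)]
    refine integral_congr_ae ?_
    filter_upwards [hh'.coeFn_toLp] with t ht
    rw [ht, planeWave_angles, Function.comp_apply]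
  convert! key using 1
  · funext δ
    simp only [Function.comp_apply, Equiv.neg_apply, neg_neg]
    rw [coeff hf, coeff hg, mul_comm]
  · rw [integral_qm_eq (f := fun k => f k * (starRingEnd ℂ) (g k))
      (hf.1.mul (Complex.continuous_conj.comp_aestronglyMeasurable hg.1))]
    refine integral_congr_ae ?_
    filter_upwards [hf'.coeFn_toLp, hg'.coeFn_toLp] with t ht ht'
    rw [ht, ht', mul_comm]
    rfl

theorem integral_planeWave_eq_zero {n : ℕ} {γ : Fin n → ℤ} (hγ : γ ≠ 0) :
    ∫ k, planeWave γ k ∂qm n = 0 := by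
  have key : inner ℂ (ContinuousMap.toLp (E := ℂ) 2 (torusHaar n) ℂ (UnitAddTorus.mFourier 0))
      (ContinuousMap.toLp (E := ℂ) 2 (torusHaar n) ℂ (UnitAddTorus.mFourier γ)) = 0 :=
    (UnitAddTorus.orthonormal_mFourier (d := Fin n)).2 hγ.symm
  rw [ContinuousMap.inner_toLp] at key
  rw [integral_qm_eq (measurable_planeWave γ).aestronglyMeasurable]
  simpa [planeWave_angles, UnitAddTorus.mFourier_zero] using key

/-- An integrable nonnegative function on the quasimomentum box whose nonconstant Fourier
coefficients all vanish is almost everywhere constant. -/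
theorem ae_eq_integral_of_integral_planeWave_mul_eq_zero {n : ℕ} {N : (Fin n → ℝ) → ℝ}
    (hN : Measurable N) (hN0 : ∀ k, 0 ≤ N k) (hNi : Integrable N (qm n))
    (h : ∀ γ : Fin n → ℤ, γ ≠ 0 → ∫ k, planeWave γ k * (N k : ℂ) ∂qm n = 0) :
    ∀ᵐ k ∂qm n, N k = ∫ k, N k ∂qm n := by
  set c : ℝ := ∫ k, N k ∂qm n with hc
  have hc0 : 0 ≤ c := integral_nonneg hN0
  have hmp := measurePreserving_angles n
  set M : UnitAddTorus (Fin n) → ℝ := fun t => N (angles n t) with hM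
  have hMm : Measurable M := hN.comp hmp.measurable
  have hMi : Integrable M (torusHaar n) := hmp.integrable_comp_of_integrable hNi
  have hfin : ∫⁻ t, ENNReal.ofReal (M t) ∂torusHaar n ≠ ⊤ := hMi.lintegral_lt_top.ne
  have : IsFiniteMeasure ((torusHaar n).withDensity fun t => ENNReal.ofReal (M t)) :=
    isFiniteMeasure_withDensity hfin
  have : IsFiniteMeasure ((torusHaar n).withDensity fun _ => ENNReal.ofReal c) :=
    isFiniteMeasure_withDensity (by simp)
  have h_int (u : UnitAddTorus (Fin n) → ℝ) (hu : Measurable u) (hu0 : ∀ t, 0 ≤ u t)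
      (g : C(UnitAddTorus (Fin n), ℂ)) :
      ∫ t, g t ∂((torusHaar n).withDensity fun t => ENNReal.ofReal (u t))
        = ∫ t, g t * (u t : ℂ) ∂torusHaar n := by
    rw [integral_withDensity_eq_integral_toReal_smul hu.ennreal_ofReal (by simp)]
    refine integral_congr_ae (.of_forall fun t => ?_)
    simp only [ENNReal.toReal_ofReal (hu0 t), Complex.real_smul, mul_comm]
  have hgi (μ : Measure (UnitAddTorus (Fin n))) [IsFiniteMeasure μ]
      (g : C(UnitAddTorus (Fin n), ℂ)) : Integrable g μ :=
    g.continuous.integrable_of_hasCompactSupport (HasCompactSupport.of_compactSpace _)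
  have hspan : ∀ g ∈ UnitAddTorus.mFourierSubalgebra (Fin n),
      ∫ t, g t ∂((torusHaar n).withDensity fun t => ENNReal.ofReal (M t))
        = ∫ t, g t ∂((torusHaar n).withDensity fun _ => ENNReal.ofReal c) := by
    intro g hg
    rw [← StarSubalgebra.mem_toSubalgebra, ← Subalgebra.mem_toSubmodule,
      UnitAddTorus.mFourierSubalgebra_coe] at hg
    induction hg using Submodule.span_induction with
    | mem g hg =>
      obtain ⟨γ, rfl⟩ := hg
      rw [h_int M hMm fun t => hN0 _, h_int (fun _ => c) measurable_const fun _ => hc0]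
      simp only [← planeWave_angles, hM]
      rw [← integral_qm_eq (f := fun k => planeWave γ k * (N k : ℂ))
          ((measurable_planeWave γ).mul
          (Complex.measurable_ofReal.comp hN)).aestronglyMeasurable,
        ← integral_qm_eq (f := fun k => planeWave γ k * (c : ℂ))
          ((measurable_planeWave γ).mul_const _).aestronglyMeasurable]
      by_cases hγ : γ = 0
      · subst hγ
        simp only [planeWave_zero, one_mul, integral_const, probReal_univ, one_smul]
        rw [hc]
        exact integral_ofReal
      · rw [h γ hγ, integral_mul_const, integral_planeWave_eq_zero hγ, zero_mul]
    | zero => simp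
    | add x y _ _ hx hy =>
      simp only [ContinuousMap.add_apply]
      rw [integral_add (hgi _ x) (hgi _ y), integral_add (hgi _ x) (hgi _ y), hx, hy]
    | smul a x _ hx =>
      simp only [ContinuousMap.smul_apply]
      rw [integral_smul, integral_smul, hx]
  have hmeas : (torusHaar n).withDensity (fun t => ENNReal.ofReal (M t))
      = (torusHaar n).withDensity fun _ => ENNReal.ofReal c := by
    refine ext_of_forall_mem_subalgebra_integral_eq_of_polish (𝕜 := ℂ)
      (A := (UnitAddTorus.mFourierSubalgebra (Fin n)).comap
        (BoundedContinuousFunction.toContinuousMapStarₐ ℂ)) ?_ fun g hg => hspan _ hg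
    intro x y hxy
    obtain ⟨_, ⟨g, hg, rfl⟩, hne⟩ := UnitAddTorus.mFourierSubalgebra_separatesPoints hxy
    exact ⟨_, ⟨g, ⟨BoundedContinuousFunction.mkOfCompact g, hg, rfl⟩, rfl⟩, hne⟩
  rw [withDensity_eq_iff hMm.ennreal_ofReal.aemeasurable aemeasurable_const hfin] at hmeas
  rw [← hmp.map_eq, ae_map_iff hmp.measurable.aemeasurable
    (measurableSet_eq_fun hN measurable_const)]
  filter_upwards [hmeas] with t ht
  exact (ENNReal.ofReal_eq_ofReal_iff (hN0 _) hc0).1 ht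

/-- The translate of `[0,1)ⁿ` by the lattice vector `δ`. -/
def latticeCell {n : ℕ} (δ : Fin n → ℤ) : Set (Fin n → ℝ) := {x | ∀ j, ⌊x j⌋ = δ j}

theorem measurableSet_latticeCell {n : ℕ} (δ : Fin n → ℤ) : MeasurableSet (latticeCell δ) := by
  have h : latticeCell δ = ⋂ j, (fun x : Fin n → ℝ => ⌊x j⌋) ⁻¹' {δ j} := by
    ext x
    simp [latticeCell]
  rw [h]
  exact .iInter fun j => (Int.measurable_floor.comp (measurable_pi_apply j)) (.singleton _)

theorem pairwise_disjoint_latticeCell (n : ℕ) :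
    Pairwise (Function.onFun Disjoint (latticeCell (n := n))) := by
  intro δ δ' h
  refine Set.disjoint_left.2 fun x hx hx' => h (funext fun j => ?_)
  rw [← hx j, hx' j]

theorem iUnion_latticeCell (n : ℕ) : ⋃ δ, latticeCell (n := n) δ = Set.univ :=
  Set.eq_univ_of_forall fun x => Set.mem_iUnion.2 ⟨fun j => ⌊x j⌋, fun _ => rfl⟩

theorem preimage_add_latticeCell {n : ℕ} (δ : Fin n → ℤ) :
    (fun x : Fin n → ℝ => x + fun j => (δ j : ℝ)) ⁻¹' latticeCell δ = Wbox n := by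
  ext x
  simp [latticeCell, Wbox, Int.floor_eq_zero_iff]

theorem lintegral_eq_lintegral_Wbox_tsum {n : ℕ} {F : (Fin n → ℝ) → ENNReal} (hF : Measurable F) :
    ∫⁻ x, F x = ∫⁻ x in Wbox n, ∑' δ : Fin n → ℤ, F (x + fun j => (δ j : ℝ)) := by
  have hm (δ : Fin n → ℤ) : Measurable fun x => F (x + fun j => (δ j : ℝ)) :=
    hF.comp (measurable_add_const _)
  rw [lintegral_tsum fun δ => (hm δ).aemeasurable, ← setLIntegral_univ, ← iUnion_latticeCell,
    lintegral_iUnion measurableSet_latticeCell (pairwise_disjoint_latticeCell n)]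
  refine tsum_congr fun δ => ?_
  rw [← preimage_add_latticeCell δ]
  exact ((measurePreserving_add_right volume _).setLIntegral_comp_preimage
    (measurableSet_latticeCell δ) hF).symm

theorem integral_eq_integral_Wbox_tsum {n : ℕ} {F : (Fin n → ℝ) → ℂ} (hF : Measurable F)
    (hFi : Integrable F) :
    ∫ x, F x = ∫ x in Wbox n, ∑' δ : Fin n → ℤ, F (x + fun j => (δ j : ℝ)) := by
  have hm (δ : Fin n → ℤ) : Measurable fun x => F (x + fun j => (δ j : ℝ)) :=
    hF.comp (measurable_add_const _)
  rw [integral_tsum (fun δ => (hm δ).aestronglyMeasurable),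
    ← setIntegral_univ, ← iUnion_latticeCell,
    integral_iUnion measurableSet_latticeCell (pairwise_disjoint_latticeCell n) hFi.integrableOn]
  · refine tsum_congr fun δ => ?_
    rw [← preimage_add_latticeCell δ]
    exact ((measurePreserving_add_right volume _).setIntegral_preimage_emb
      (measurableEmbedding_addRight _) F _).symm
  · rw [← lintegral_tsum fun δ => (hm δ).enorm.aemeasurable,
      ← lintegral_eq_lintegral_Wbox_tsum hF.enorm]
    exact hFi.2.ne

theorem ae_qm_iff {n : ℕ} {p : (Fin n → ℝ) → Prop} :
    (∀ᵐ k ∂qm n, p k) ↔ ∀ᵐ k ∂volume.restrict (kbox n), p k := by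
  rw [qm, Measure.ae_ennreal_smul_measure_iff (by simp)]

theorem measurable_wannier {n : ℕ} {φ : (Fin n → ℝ) → (Fin n → ℝ) → ℂ}
    (hmeas : Measurable (Function.uncurry φ)) : Measurable (wannier n φ) :=
  ((hmeas.comp measurable_swap).stronglyMeasurable.integral_prod_right (ν := qm n)
    (f := fun x k => φ k x)).measurable

theorem ae_wannier_add {n : ℕ} {φ : (Fin n → ℝ) → (Fin n → ℝ) → ℂ}
    (hBloch : ∀ γ : Fin n → ℤ,
      ∀ᵐ p ∂((volume : Measure (Fin n → ℝ)).prod (volume : Measure (Fin n → ℝ))),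
        φ p.1 (fun j => p.2 j + (γ j : ℝ))
          = Complex.exp (Complex.I * ((∑ j, p.1 j * (γ j : ℝ) : ℝ) : ℂ)) * φ p.1 p.2) :
    ∀ᵐ x, ∀ δ : Fin n → ℤ,
      wannier n φ (x + fun j => (δ j : ℝ)) = ∫ k, planeWave δ k * φ k x ∂qm n := by
  refine ae_all_iff.2 fun δ => ?_
  have h := Measure.ae_ae_of_ae_prod
    ((Measure.measurePreserving_swap (μ := volume) (ν := volume)).quasiMeasurePreserving.ae
      (hBloch δ))
  filter_upwards [h] with x hx
  refine integral_congr_ae (ae_qm_iff.2 (ae_restrict_of_ae ?_))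
  filter_upwards [hx] with k hk
  exact hk

theorem ae_memLp_bloch {n : ℕ} {φ : (Fin n → ℝ) → (Fin n → ℝ) → ℂ}
    (hmeas : Measurable (Function.uncurry φ))
    (hL2 : Integrable (fun p : (Fin n → ℝ) × (Fin n → ℝ) => ‖φ p.1 p.2‖ ^ 2)
      ((qm n).prod (volume.restrict (Wbox n)))) :
    ∀ᵐ x ∂volume.restrict (Wbox n), MemLp (fun k => φ k x) 2 (qm n) := by
  filter_upwards [hL2.prod_left_ae] with x hx
  exact (memLp_two_iff_integrable_sq_norm
    (hmeas.comp measurable_prodMk_right).aestronglyMeasurable).2 hx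

theorem MeasureTheory.MemLp.planeWave_mul {n : ℕ} {f : (Fin n → ℝ) → ℂ} (hf : MemLp f 2 (qm n))
    (γ : Fin n → ℤ) : MemLp (fun k => planeWave γ k * f k) 2 (qm n) :=
  hf.congr_norm ((measurable_planeWave γ).aestronglyMeasurable.mul hf.1)
    (.of_forall fun k => by rw [norm_mul, norm_planeWave, one_mul])

/-- The Wannier function of a square-integrable Bloch family is square-integrable. -/
theorem memLp_wannier {n : ℕ} {φ : (Fin n → ℝ) → (Fin n → ℝ) → ℂ}
    (hmeas : Measurable (Function.uncurry φ))
    (hBloch : ∀ γ : Fin n → ℤ,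
      ∀ᵐ p ∂((volume : Measure (Fin n → ℝ)).prod (volume : Measure (Fin n → ℝ))),
        φ p.1 (fun j => p.2 j + (γ j : ℝ))
          = Complex.exp (Complex.I * ((∑ j, p.1 j * (γ j : ℝ) : ℝ) : ℂ)) * φ p.1 p.2)
    (hL2 : Integrable (fun p : (Fin n → ℝ) × (Fin n → ℝ) => ‖φ p.1 p.2‖ ^ 2)
      ((qm n).prod (volume.restrict (Wbox n)))) :
    MemLp (wannier n φ) 2 volume := by
  have hw := measurable_wannier hmeas
  refine (memLp_two_iff_integrable_sq_norm hw.aestronglyMeasurable).2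
    ⟨(hw.norm.pow_const 2).aestronglyMeasurable, ?_⟩
  rw [hasFiniteIntegral_iff_ofReal (.of_forall fun x => by positivity),
    lintegral_eq_lintegral_Wbox_tsum (hw.norm.pow_const 2).ennreal_ofReal]
  refine lt_of_eq_of_lt (lintegral_congr_ae ?_) hL2.integral_prod_right.lintegral_lt_top
  filter_upwards [ae_restrict_of_ae (ae_wannier_add hBloch), ae_memLp_bloch hmeas hL2]
    with x hx hφx
  have hsum : HasSum (fun δ : Fin n → ℤ => ‖wannier n φ (x + fun j => (δ j : ℝ))‖ ^ 2)
      (∫ k, ‖φ k x‖ ^ 2 ∂qm n) := by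
    rw [← Complex.hasSum_ofReal, ← integral_complex_ofReal]
    convert! hasSum_mul_conj_integral_planeWave hφx hφx using 2
    · rw [hx, Complex.mul_conj']
      push_cast
      rfl
    · funext k
      rw [Complex.mul_conj']
      push_cast
      rfl
  rw [← ENNReal.ofReal_tsum_of_nonneg (fun δ => by positivity) hsum.summable, hsum.tsum_eq]

/-- The `L²(ℝⁿ)` inner products of lattice shifts of a Wannier function are the Fourier
coefficients of the squared norms of the Bloch functions on the fundamental domain. -/
theorem integral_wannier_mul_conj_wannier {n : ℕ} {φ : (Fin n → ℝ) → (Fin n → ℝ) → ℂ}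
    (hmeas : Measurable (Function.uncurry φ))
    (hBloch : ∀ γ : Fin n → ℤ,
      ∀ᵐ p ∂((volume : Measure (Fin n → ℝ)).prod (volume : Measure (Fin n → ℝ))),
        φ p.1 (fun j => p.2 j + (γ j : ℝ))
          = Complex.exp (Complex.I * ((∑ j, p.1 j * (γ j : ℝ) : ℝ) : ℂ)) * φ p.1 p.2)
    (hL2 : Integrable (fun p : (Fin n → ℝ) × (Fin n → ℝ) => ‖φ p.1 p.2‖ ^ 2)
      ((qm n).prod (volume.restrict (Wbox n)))) (γ γ' : Fin n → ℤ) :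
    ∫ x : Fin n → ℝ, wannier n φ (fun j => x j - (γ j : ℝ))
        * (starRingEnd ℂ) (wannier n φ (fun j => x j - (γ' j : ℝ)))
      = ∫ k, planeWave (γ' - γ) k * ((∫ x in Wbox n, ‖φ k x‖ ^ 2 : ℝ) : ℂ) ∂qm n := by
  have hw := measurable_wannier hmeas
  have hL := memLp_wannier hmeas hBloch hL2
  have hshift (γ : Fin n → ℤ) : MemLp (fun x : Fin n → ℝ => wannier n φ fun j => x j - (γ j : ℝ)) 2 volume :=
    hL.comp_measurePreserving (measurePreserving_sub_right volume fun j => (γ j : ℝ))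
  have hshiftm (γ : Fin n → ℤ) : Measurable fun x : Fin n → ℝ => wannier n φ fun j => x j - (γ j : ℝ) :=
    hw.comp (by fun_prop)
  rw [integral_eq_integral_Wbox_tsum (F := fun x : Fin n → ℝ => wannier n φ (fun j =>
      x j - (γ j : ℝ)) * (starRingEnd ℂ) (wannier n φ (fun j => x j - (γ' j : ℝ))))
    ((hshiftm γ).mul (Complex.continuous_conj.measurable.comp (hshiftm γ')))
    ((hshift γ).integrable_mul (hshift γ').star)]
  have h_int : Integrable (fun p : (Fin n → ℝ) × (Fin n → ℝ) =>
      planeWave (γ' - γ) p.1 * ((‖φ p.1 p.2‖ ^ 2 : ℝ) : ℂ))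
      ((qm n).prod (volume.restrict (Wbox n))) :=
    hL2.ofReal.bdd_mul (c := 1)
      ((measurable_planeWave _).comp measurable_fst).aestronglyMeasurable
      (.of_forall fun p => (norm_planeWave _ _).le)
  calc _ = ∫ x in Wbox n, ∫ k, planeWave (γ' - γ) k * ((‖φ k x‖ ^ 2 : ℝ) : ℂ) ∂qm n := by
        refine integral_congr_ae ?_
        filter_upwards [ae_restrict_of_ae (ae_wannier_add hBloch), ae_memLp_bloch hmeas hL2]
          with x hx hφx
        have hval (γ δ : Fin n → ℤ) : wannier n φ (fun j => (x + fun j => (δ j : ℝ)) j - (γ j : ℝ))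
            = ∫ k, planeWave δ k * (planeWave (-γ) k * φ k x) ∂qm n := by
          have : (fun j => (x + fun j => (δ j : ℝ)) j - (γ j : ℝ))
              = x + fun j => (((δ + -γ) j : ℤ) : ℝ) := by
            funext j
            simp only [Pi.add_apply, Pi.neg_apply]
            push_cast
            ring
          rw [this, hx]
          simp only [planeWave_add, mul_assoc]
        simp only [hval]
        rw [(hasSum_mul_conj_integral_planeWave (hφx.planeWave_mul (-γ))
          (hφx.planeWave_mul (-γ'))).tsum_eq]
        refine integral_congr_ae (.of_forall fun k => ?_)
        simp only [map_mul, conj_planeWave, neg_neg]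
        rw [sub_eq_add_neg, planeWave_add, Complex.ofReal_pow, ← Complex.mul_conj']
        ring
    _ = ∫ k, (∫ x in Wbox n, planeWave (γ' - γ) k * ((‖φ k x‖ ^ 2 : ℝ) : ℂ)) ∂qm n :=
        (integral_integral_swap h_int).symm
    _ = _ := by
        refine integral_congr_ae (.of_forall fun k => ?_)
        simp only
        rw [integral_const_mul, integral_complex_ofReal]

/-- the lattice shifts `w_γ = w(· - γ)` of the Wannier function
`w(x) = ∫_{[0,2π)ⁿ} φ(k,x) d'k` are mutually orthogonal in `L²(ℝⁿ)` if and only if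
`k ↦ ‖φ(k,·)‖_{L²(W)}` is constant for a.e. `k ∈ [0,2π)ⁿ`. -/
theorem wannier_shifts_orthogonal_iff_const_norm (n : ℕ)
    (φ : (Fin n → ℝ) → (Fin n → ℝ) → ℂ)
    -- `φ` is jointly measurable:
    (hmeas : Measurable (Function.uncurry φ))
    -- `φ` is `2πℤⁿ`-periodic in the quasimomentum `k`:
    (hper : ∀ γ : Fin n → ℤ,
      ∀ᵐ p ∂((volume : Measure (Fin n → ℝ)).prod (volume : Measure (Fin n → ℝ))),
        φ (fun j => p.1 j + 2 * Real.pi * (γ j : ℝ)) p.2 = φ p.1 p.2)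
    -- `φ` is of Bloch form in `x` with quasimomentum `k`:
    (hBloch : ∀ γ : Fin n → ℤ,
      ∀ᵐ p ∂((volume : Measure (Fin n → ℝ)).prod (volume : Measure (Fin n → ℝ))),
        φ p.1 (fun j => p.2 j + (γ j : ℝ))
          = Complex.exp (Complex.I * ((∑ j, p.1 j * (γ j : ℝ) : ℝ) : ℂ)) * φ p.1 p.2)
    -- square integrability: `∫_{[0,2π)ⁿ} ∫_W |φ(k,x)|² dx d'k < ∞`:
    (hL2 : Integrable (fun p : (Fin n → ℝ) × (Fin n → ℝ) => ‖φ p.1 p.2‖ ^ 2)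
      ((qm n).prod (volume.restrict (Wbox n)))) :
    -- mutual orthogonality of the lattice shifts of `w` ⟷ a.e. constancy of `‖φ(k,·)‖_{L²(W)}`:
    (∀ γ γ' : Fin n → ℤ, γ ≠ γ' →
        ∫ x, wannier n φ (fun j => x j - (γ j : ℝ))
            * (starRingEnd ℂ) (wannier n φ (fun j => x j - (γ' j : ℝ)))
          ∂(volume : Measure (Fin n → ℝ)) = 0)
      ↔ ∃ c : ℝ, ∀ᵐ k ∂(volume.restrict (kbox n)), ∫ x in Wbox n, ‖φ k x‖ ^ 2 = c := by
  set N : (Fin n → ℝ) → ℝ := fun k => ∫ x in Wbox n, ‖φ k x‖ ^ 2 with hN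
  have hNm : Measurable N :=
    ((hmeas.norm.pow_const 2).stronglyMeasurable.integral_prod_right
      (f := fun k x => ‖φ k x‖ ^ 2)).measurable
  simp only [integral_wannier_mul_conj_wannier hmeas hBloch hL2, ← ae_qm_iff]
  constructor
  · intro h
    refine ⟨_, ae_eq_integral_of_integral_planeWave_mul_eq_zero hNm
      (fun k => integral_nonneg fun x => by positivity) hL2.integral_prod_left fun γ hγ => ?_⟩
    simpa using h 0 γ hγ.symm
  · rintro ⟨c, hc⟩ γ γ' hγ
    rw [← zero_mul (c : ℂ), ← integral_planeWave_eq_zero (sub_ne_zero.2 hγ.symm),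
      ← integral_mul_const]
    refine integral_congr_ae ?_
    filter_upwards [hc] with k hk
    rw [hk]
end
end
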